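/- Let r ≥ 2, t ≥ 3, k ≥ 1 be integers with k ≥ t-3, and let G be a graph on n vertices where (r-1)(t-1)k < n ≤ (r-1)(t-1)(k+1) and δ(G) ≥ n - ⌈(k/(k+1))·⌈n/(r-1)⌉⌉. Then for every 2-coloring of the edges of G in red and blue, either the red subgraph contains a clique K_r or the blue subgraph contains a path on t vertices. -/

import Mathlib

open Classical in
/-- The neighbors of `v` in `G` that lie in the finite set `S`. -/
noncomputable def nbrIn {V : Type*} (G : SimpleGraph V) (S : Finset V) (v : V) : Finset V :=
  S.filter (G.Adj v)

theorem mem_nbrIn {V : Type*} {G : SimpleGraph V} {S : Finset V} {v x : V} :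
    x ∈ nbrIn G S v ↔ x ∈ S ∧ G.Adj v x := by
  simp [nbrIn]

/-- `l` lists the vertices of a path of `G` inside `S`. -/
def IsPathList {V : Type*} (G : SimpleGraph V) (S : Finset V) (l : List V) : Prop :=
  l.IsChain G.Adj ∧ l.Nodup ∧ ∀ x ∈ l, x ∈ S

section PathLists

variable {V : Type*} {G : SimpleGraph V} {S : Finset V}

theorem IsPathList.exists_walk {l : List V} (hl : IsPathList G S l) (hne : l ≠ []) :
    ∃ (u v : V) (p : G.Walk u v), p.IsPath ∧ p.length + 1 = l.length := by
  refine ⟨_, _, SimpleGraph.Walk.ofSupport l hne hl.1, ?_, ?_⟩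
  · rw [SimpleGraph.Walk.isPath_def, SimpleGraph.Walk.support_ofSupport]
    exact hl.2.1
  · rw [← SimpleGraph.Walk.length_support, SimpleGraph.Walk.support_ofSupport]

variable [DecidableEq V]

theorem nbrIn_subset_of_maximal {h : V} {l : List V} (hl : IsPathList G S (h :: l))
    (hmax : ∀ x, ¬ IsPathList G S (x :: h :: l)) : nbrIn G S h ⊆ l.toFinset := by
  intro x hx
  rw [mem_nbrIn] at hx
  by_contra hxl
  refine hmax x ⟨List.isChain_cons_cons.2 ⟨hx.2.symm, hl.1⟩, ?_, ?_⟩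
  · refine List.nodup_cons.2 ⟨?_, hl.2.1⟩
    rw [List.mem_cons, not_or]
    exact ⟨hx.2.ne', by simpa using hxl⟩
  · intro y hy
    rcases List.mem_cons.1 hy with rfl | hy
    exacts [hx.1, hl.2.2 y hy]

theorem exists_pathList {c : ℕ} (hdeg : ∀ v ∈ S, c ≤ (nbrIn G S v).card) {v : V} (hv : v ∈ S) :
    ∃ l, IsPathList G S l ∧ l.length = c + 1 ∧ v ∈ l := by
  suffices H : ∀ i ≤ c, ∃ l, IsPathList G S l ∧ l.length = i + 1 ∧ v ∈ l from H c le_rfl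
  intro i
  induction i with
  | zero => exact fun _ => ⟨[v], by simp [IsPathList, hv]⟩
  | succ i ih =>
    intro hi
    obtain ⟨l, hl, hlen, hvl⟩ := ih (by omega)
    obtain _ | ⟨h, l⟩ := l
    · simp at hlen
    by_contra! hcon
    have hsub := nbrIn_subset_of_maximal hl fun x hx =>
      hcon _ hx (by simpa using hlen) (List.mem_cons_of_mem _ hvl)
    have h1 := Finset.card_le_card hsub
    have h2 := l.toFinset_card_le
    have h3 := hdeg h (hl.2.2 h (by simp))
    simp at hlen
    omega

/-- If the degrees are at least `s - 1` and there is no path on `s + 1` vertices, then the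
component of every vertex is a clique on `s` vertices. -/
theorem exists_component {s : ℕ} (hs : 2 ≤ s) (hdeg : ∀ v ∈ S, s - 1 ≤ (nbrIn G S v).card)
    (hP : ∀ l, IsPathList G S l → l.length ≠ s + 1) {v : V} (hv : v ∈ S) :
    ∃ T ⊆ S, v ∈ T ∧ T.card = s ∧ ∀ u ∈ T, nbrIn G S u = T.erase u := by
  have key : ∀ (h : V) (l : List V), IsPathList G S (h :: l) → (h :: l).length = s →
      nbrIn G S h = l.toFinset := by
    intro h l hl hlen
    refine Finset.eq_of_subset_of_card_le
      (nbrIn_subset_of_maximal hl fun x hx => hP _ hx (by simpa using hlen)) ?_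
    have h1 := l.toFinset_card_le
    have h2 := hdeg h (hl.2.2 h (by simp))
    simp at hlen
    omega
  obtain ⟨l, hl, hlen, hvl⟩ := exists_pathList hdeg hv
  have hlen : l.length = s := by omega
  refine ⟨l.toFinset, fun x hx => hl.2.2 x (by simpa using hx), by simpa using hvl,
    by rw [List.toFinset_card_of_nodup hl.2.1, hlen], ?_⟩
  intro u hu
  rw [List.mem_toFinset] at hu
  obtain ⟨a, b, rfl⟩ := List.append_of_mem hu
  have hperm : (u :: b ++ a).Perm (a ++ u :: b) := List.perm_append_comm
  have hrot : IsPathList G S (u :: (b ++ a)) := by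
    refine ⟨?_, hperm.nodup_iff.2 hl.2.1, fun x hx => hl.2.2 x (hperm.mem_iff.1 hx)⟩
    have h1 := List.isChain_append.1 hl.1
    rw [← List.cons_append]
    refine List.isChain_append.2 ⟨h1.2.1, h1.1, ?_⟩
    intro x hx y hy
    obtain _ | ⟨h, a⟩ := a
    · simp at hy
    obtain rfl : h = y := by simpa using hy
    have h2 := key h (a ++ u :: b) hl hlen
    have h3 : x ∈ nbrIn G S h := by
      rw [h2, List.mem_toFinset]
      exact List.mem_append_right _ (List.mem_of_mem_getLast? hx)
    exact (mem_nbrIn.1 h3).2.symm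
  rw [key u _ hrot (by rw [← hlen]; exact hperm.length_eq)]
  have h4 := List.nodup_cons.1 hrot.2.1
  ext x
  have h5 : x = u → x ∉ b ++ a := fun h => h ▸ h4.1
  simp only [List.mem_toFinset, Finset.mem_erase, ← hperm.mem_iff, List.cons_append,
    List.mem_cons]
  tauto

/-- A set closed under taking neighbors is a union of components, hence of cliques on `s`
vertices. -/
theorem dvd_card_of_closed {s : ℕ}
    (hT : ∀ v ∈ S, ∃ T ⊆ S, v ∈ T ∧ T.card = s ∧ ∀ u ∈ T, nbrIn G S u = T.erase u)
    {Q : Finset V} (hQ : Q ⊆ S) (hclosed : ∀ v ∈ Q, nbrIn G S v ⊆ Q) : s ∣ Q.card := by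
  rw [Finset.card_eq_sum_card_image (fun v => insert v (nbrIn G S v)) Q]
  refine Finset.dvd_sum fun C hC => ?_
  obtain ⟨v, hv, rfl⟩ := Finset.mem_image.1 hC
  obtain ⟨T, hTS, hvT, hTc, hTn⟩ := hT v (hQ hv)
  have hcl : ∀ u ∈ T, insert u (nbrIn G S u) = T := fun u hu => by
    rw [hTn u hu, Finset.insert_erase hu]
  have : (Q.filter fun a => insert a (nbrIn G S a) = insert v (nbrIn G S v)) = T := by
    ext x
    rw [Finset.mem_filter, hcl v hvT]
    constructor
    · rintro ⟨-, h⟩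
      exact h ▸ Finset.mem_insert_self _ _
    · intro hx
      refine ⟨?_, hcl x hx⟩
      by_cases hxv : x = v
      · exact hxv ▸ hv
      · exact hclosed v hv (hTn v hvT ▸ Finset.mem_erase.2 ⟨hxv, hx⟩)
  rw [this, hTc]

end PathLists

section IndependentSets

variable {V : Type*}

theorem nbrIn_eq_of_card_le {H : SimpleGraph V} {S A : Finset V} {q : ℕ} {v : V}
    (hv : (nbrIn H S v).card ≤ q) (hA : A ⊆ nbrIn H S v) (hq : q ≤ A.card) :
    nbrIn H S v = A :=
  (Finset.eq_of_subset_of_card_le hA (hv.trans hq)).symm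

variable [DecidableEq V]

theorem clique_sup_edge {H : SimpleGraph V} {a b : V} {C : Finset V}
    (hC : (H ⊔ SimpleGraph.edge a b).IsClique C) (hn : ¬ H.IsClique C) :
    a ∈ C ∧ b ∈ C ∧ ∀ x ∈ C, ∀ y ∈ C, x ≠ y →
      H.Adj x y ∨ (x = a ∧ y = b) ∨ (x = b ∧ y = a) := by
  have h : ∀ x ∈ C, ∀ y ∈ C, x ≠ y → H.Adj x y ∨ (x = a ∧ y = b) ∨ (x = b ∧ y = a) := by
    intro x hx y hy hxy
    have := hC hx hy hxy
    rw [SimpleGraph.sup_adj, SimpleGraph.edge_adj] at this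
    tauto
  by_cases hab : a ∈ C ∧ b ∈ C
  · exact ⟨hab.1, hab.2, h⟩
  · refine (hn fun x hx y hy hxy => ?_).elim
    rcases h x hx y hy hxy with h | ⟨rfl, rfl⟩ | ⟨rfl, rfl⟩
    exacts [h, (hab ⟨hx, hy⟩).elim, (hab ⟨hy, hx⟩).elim]

/-- If every vertex of a `q`-clique `Q` has exactly one outer neighbor, then two distinct outer
neighbors may be joined by an edge without creating a clique on `q + 1` vertices outside `Q`. -/
theorem exists_good_pair {H : SimpleGraph V} {S Q : Finset V} {q : ℕ} (hq : 3 ≤ q)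
    (hdeg : ∀ v ∈ S, (nbrIn H S v).card ≤ q)
    (hcl : ∀ C ⊆ S, C.card = q + 1 → ¬ H.IsClique C)
    (hQS : Q ⊆ S) (hQc : Q.card = q) (hQ : H.IsClique Q)
    (f : V → V) (hfS : ∀ x ∈ Q, f x ∈ S \ Q) (hfa : ∀ x ∈ Q, H.Adj x (f x)) :
    ∃ x ∈ Q, ∃ y ∈ Q, f x ≠ f y ∧ ∀ C ⊆ S \ Q, C.card = q + 1 →
      ¬ (H ⊔ SimpleGraph.edge (f x) (f y)).IsClique C := by
  obtain ⟨x, hx, y, hy, hxy⟩ : ∃ x ∈ Q, ∃ y ∈ Q, f x ≠ f y := by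
    by_contra! hcon
    obtain ⟨x, hx⟩ : Q.Nonempty := Finset.card_pos.1 (by omega)
    have h1 := Finset.mem_sdiff.1 (hfS x hx)
    refine hcl (insert (f x) Q) (Finset.insert_subset h1.1 hQS)
      (by rw [Finset.card_insert_of_notMem h1.2, hQc]) ?_
    rw [Finset.coe_insert]
    refine hQ.insert fun y hy _ => ?_
    rw [hcon x hx y hy]
    exact (hfa y hy).symm
  by_contra! hcon
  obtain ⟨C, hCS, hCc, hC⟩ := hcon x hx y hy hxy
  have hCS' : C ⊆ S := hCS.trans Finset.sdiff_subset
  have hdisj : ∀ z ∈ C, z ∉ Q := fun z hz => (Finset.mem_sdiff.1 (hCS hz)).2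
  obtain ⟨haC, hbC, hadj⟩ := clique_sup_edge hC (hcl C hCS' hCc)
  have hCab : ((C.erase (f x)).erase (f y)).card + 1 = q := by
    rw [Finset.card_erase_of_mem (Finset.mem_erase.2 ⟨hxy.symm, hbC⟩),
      Finset.card_erase_of_mem haC]
    omega
  have hend : ∀ v ∈ Q, (∀ z ∈ (C.erase (f x)).erase (f y), H.Adj (f v) z) →
      nbrIn H S (f v) = insert v ((C.erase (f x)).erase (f y)) := by
    intro v hv h
    have hvC : v ∉ (C.erase (f x)).erase (f y) := fun h =>
      hdisj v (Finset.mem_of_mem_erase (Finset.mem_of_mem_erase h)) hv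
    refine nbrIn_eq_of_card_le (hdeg _ (Finset.mem_sdiff.1 (hfS v hv)).1) ?_
      (by rw [Finset.card_insert_of_notMem hvC]; omega)
    refine Finset.insert_subset (mem_nbrIn.2 ⟨hQS hv, (hfa v hv).symm⟩) fun z hz => ?_
    exact mem_nbrIn.2
      ⟨hCS' (Finset.mem_of_mem_erase (Finset.mem_of_mem_erase hz)), h z hz⟩
  have hna := hend x hx fun z hz => by
    simp only [Finset.mem_erase] at hz
    have := hadj _ haC z hz.2.2 (Ne.symm hz.2.1)
    tauto
  have hnb := hend y hy fun z hz => by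
    simp only [Finset.mem_erase] at hz
    have := hadj _ hbC z hz.2.2 (Ne.symm hz.1)
    tauto
  have hmid : ∀ z ∈ C, z ≠ f x → z ≠ f y → nbrIn H S z = C.erase z := by
    intro z hz hza hzb
    refine nbrIn_eq_of_card_le (hdeg _ (hCS' hz)) ?_
      (by rw [Finset.card_erase_of_mem hz]; omega)
    intro u hu
    rw [Finset.mem_erase] at hu
    have := hadj z hz u hu.2 hu.1.symm
    exact mem_nbrIn.2 ⟨hCS' hu.2, by tauto⟩
  obtain ⟨w, hw⟩ : ((Q.erase x).erase y).Nonempty := by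
    refine Finset.card_pos.1 ?_
    have h1 := Finset.pred_card_le_card_erase (s := Q.erase x) (a := y)
    have h2 := Finset.pred_card_le_card_erase (s := Q) (a := x)
    omega
  simp only [Finset.mem_erase] at hw
  obtain ⟨hwy, hwx, hw⟩ := hw
  have hfw := Finset.mem_sdiff.1 (hfS w hw)
  have hne : ∀ v, v ≠ w → nbrIn H S (f v) = insert v ((C.erase (f x)).erase (f y)) →
      f w ≠ f v := by
    intro v hvw hv hwv
    have h : w ∈ nbrIn H S (f v) :=
      mem_nbrIn.2 ⟨hQS hw, hwv ▸ (hfa w hw).symm⟩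
    rw [hv, Finset.mem_insert, Finset.mem_erase, Finset.mem_erase] at h
    rcases h with h | h
    exacts [hvw h.symm, hdisj w h.2.2 hw]
  have hwa := hne x (Ne.symm hwx) hna
  have hwb := hne y (Ne.symm hwy) hnb
  obtain ⟨D, hDS, hDc, hD⟩ := hcon x hx w hw hwa.symm
  obtain ⟨haD, hwD, hadj'⟩ :=
    clique_sup_edge hD (hcl D (hDS.trans Finset.sdiff_subset) hDc)
  obtain ⟨z, hz⟩ : ((D.erase (f x)).erase (f w)).Nonempty := by
    refine Finset.card_pos.1 ?_
    have h1 := Finset.pred_card_le_card_erase (s := D.erase (f x)) (a := f w)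
    have h2 := Finset.pred_card_le_card_erase (s := D) (a := f x)
    omega
  simp only [Finset.mem_erase] at hz
  obtain ⟨hzw, hza, hzD⟩ := hz
  have hzSQ := Finset.mem_sdiff.1 (hDS hzD)
  have h1 : H.Adj (f x) z := by
    have := hadj' _ haD z hzD (Ne.symm hza)
    tauto
  have h2 : H.Adj z (f w) := by
    have := hadj' z hzD _ hwD hzw
    tauto
  have h3 : z ∈ nbrIn H S (f x) := mem_nbrIn.2 ⟨hzSQ.1, h1⟩
  rw [hna, Finset.mem_insert, Finset.mem_erase, Finset.mem_erase] at h3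
  rcases h3 with rfl | ⟨hzb, -, hzC⟩
  · exact hzSQ.2 hx
  have h4 : f w ∈ nbrIn H S z := mem_nbrIn.2 ⟨hfw.1, h2⟩
  rw [hmid z hzC hza hzb] at h4
  have h5 : w ∈ nbrIn H S (f w) := mem_nbrIn.2 ⟨hQS hw, (hfa w hw).symm⟩
  rw [hmid _ (Finset.mem_of_mem_erase h4) hwa hwb] at h5
  exact hdisj w (Finset.mem_of_mem_erase h5) hw

/-- An instance of Fajtlowicz's bound: without cliques on `q` vertices, maximum degree `q` forces
an independent set of density `1 / q`. -/
theorem exists_indep_of_cliqueFree {H : SimpleGraph V} {S : Finset V} {q : ℕ} (hq : 2 ≤ q)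
    (hdeg : ∀ v ∈ S, (nbrIn H S v).card ≤ q)
    (hcl : ∀ C ⊆ S, C.card = q → ¬ H.IsClique C) :
    ∃ I ⊆ S, H.IsIndepSet I ∧ S.card ≤ q * I.card := by
  classical
  obtain ⟨I, hI, hmax⟩ := Finset.exists_max_image
    (S.powerset.filter fun I : Finset V => H.IsIndepSet (SetLike.coe I)) Finset.card
    ⟨∅, by simp [SimpleGraph.IsIndepSet]⟩
  simp only [Finset.mem_filter, Finset.mem_powerset] at hI hmax
  obtain ⟨hIS, hI⟩ := hI
  refine ⟨I, hIS, hI, ?_⟩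
  have hdom : ∀ v ∈ S \ I, (nbrIn H I v).Nonempty := by
    intro v hv
    rw [Finset.mem_sdiff] at hv
    by_contra hcon
    have h := hmax (insert v I) ⟨Finset.insert_subset hv.1 hIS, by
      rw [Finset.coe_insert]
      refine Set.Pairwise.insert hI fun x hx _ => ?_
      have h1 : ¬ H.Adj v x := fun h => hcon ⟨x, mem_nbrIn.2 ⟨hx, h⟩⟩
      exact ⟨h1, fun h => h1 h.symm⟩⟩
    rw [Finset.card_insert_of_notMem hv.2] at h
    omega
  have hpriv : ∀ x ∈ I, ((S \ I).filter fun v => nbrIn H I v = {x}).card + 2 ≤ q := by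
    intro x hx
    set P := (S \ I).filter fun v => nbrIn H I v = {x} with hP
    have hPa : ∀ v ∈ P, v ∈ S ∧ v ∉ I ∧ ∀ y ∈ I, H.Adj v y ↔ y = x := by
      intro v hv
      rw [hP, Finset.mem_filter, Finset.mem_sdiff] at hv
      refine ⟨hv.1.1, hv.1.2, fun y hy => ?_⟩
      have := Finset.ext_iff.1 hv.2 y
      rw [mem_nbrIn, Finset.mem_singleton] at this
      tauto
    have hxP : x ∉ P := fun h => (hPa x h).2.1 hx
    have hclq : H.IsClique (insert x P : Finset V) := by
      rw [Finset.coe_insert]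
      refine SimpleGraph.IsClique.insert (fun v hv w hw hvw => ?_) fun v hv _ =>
        (((hPa v hv).2.2 x hx).2 rfl).symm
      by_contra hadj
      have hvI := hPa v hv
      have hwI := hPa w hw
      have h := hmax (insert v (insert w (I.erase x))) ⟨?_, ?_⟩
      · rw [Finset.card_insert_of_notMem, Finset.card_insert_of_notMem,
          Finset.card_erase_of_mem hx] at h
        · have := Finset.card_pos.2 ⟨x, hx⟩
          omega
        · exact fun h => hwI.2.1 (Finset.mem_of_mem_erase h)
        · rw [Finset.mem_insert, not_or]
          exact ⟨hvw, fun h => hvI.2.1 (Finset.mem_of_mem_erase h)⟩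
      · exact Finset.insert_subset hvI.1 (Finset.insert_subset hwI.1
          ((Finset.erase_subset _ _).trans hIS))
      · rw [Finset.coe_insert, Finset.coe_insert]
        have hsep : ∀ u ∈ P, ∀ y ∈ I.erase x, ¬ H.Adj u y := fun u hu y hy h =>
          Finset.ne_of_mem_erase hy
            (((hPa u hu).2.2 y (Finset.mem_of_mem_erase hy)).1 h)
        refine Set.Pairwise.insert (Set.Pairwise.insert
          (hI.mono (Finset.coe_subset.2 (Finset.erase_subset _ _))) fun y hy _ => ?_)
          fun y hy _ => ?_
        · exact ⟨hsep w hw y hy, fun h => hsep w hw y hy h.symm⟩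
        · have : ¬ H.Adj v y := by
            rcases hy with rfl | hy
            exacts [hadj, hsep v hv y hy]
          exact ⟨this, fun h => this h.symm⟩
    by_contra hcon
    obtain ⟨C, hCP, hCc⟩ := Finset.exists_subset_card_eq
      (s := insert x P) (n := q) (by rw [Finset.card_insert_of_notMem hxP]; omega)
    refine hcl C (hCP.trans (Finset.insert_subset (hIS hx) fun v hv => (hPa v hv).1)) hCc
      (hclq.subset (Finset.coe_subset.2 hCP))
  have hleft : ∑ x ∈ I, (((S \ I).filter fun v => H.Adj v x).card +
      ((S \ I).filter fun v => nbrIn H I v = {x}).card) ≤ ∑ _x ∈ I, (2 * q - 2) := by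
    refine Finset.sum_le_sum fun x hx => ?_
    have h1 := hpriv x hx
    have h2 : ((S \ I).filter fun v => H.Adj v x).card ≤ q := by
      refine le_trans (Finset.card_le_card fun v hv => ?_) (hdeg x (hIS hx))
      rw [Finset.mem_filter, Finset.mem_sdiff] at hv
      exact mem_nbrIn.2 ⟨hv.1.1, hv.2.symm⟩
    omega
  have hright : ∑ _v ∈ S \ I, 2 ≤ ∑ v ∈ S \ I, ((I.filter fun x => H.Adj v x).card +
      (I.filter fun x => nbrIn H I v = {x}).card) := by
    refine Finset.sum_le_sum fun v hv => ?_
    have h1 : (I.filter fun x => H.Adj v x) = nbrIn H I v := by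
      ext; simp [mem_nbrIn]
    have h2 := Finset.card_pos.2 (hdom v hv)
    rw [h1]
    by_cases h3 : (nbrIn H I v).card = 1
    · obtain ⟨x, hx⟩ := Finset.card_eq_one.1 h3
      have : 0 < (I.filter fun x => nbrIn H I v = {x}).card := by
        refine Finset.card_pos.2 ⟨x, Finset.mem_filter.2 ⟨?_, hx⟩⟩
        have : x ∈ nbrIn H I v := by simp [hx]
        exact (mem_nbrIn.1 this).1
      omega
    · omega
  have hswap : ∑ x ∈ I, (((S \ I).filter fun v => H.Adj v x).card +
      ((S \ I).filter fun v => nbrIn H I v = {x}).card) =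
      ∑ v ∈ S \ I, ((I.filter fun x => H.Adj v x).card +
      (I.filter fun x => nbrIn H I v = {x}).card) := by
    rw [Finset.sum_add_distrib, Finset.sum_add_distrib]
    congr 1
    · exact (Finset.sum_card_bipartiteAbove_eq_sum_card_bipartiteBelow H.Adj).symm
    · exact (Finset.sum_card_bipartiteAbove_eq_sum_card_bipartiteBelow
        fun v x => nbrIn H I v = {x}).symm
  rw [hswap] at hleft
  have h := hright.trans hleft
  simp only [Finset.sum_const, smul_eq_mul, Finset.card_sdiff_of_subset hIS] at h
  have h2 := Finset.card_le_card hIS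
  obtain ⟨p, rfl⟩ := Nat.exists_eq_add_of_le hq
  obtain ⟨c, hc⟩ := Nat.exists_eq_add_of_le h2
  rw [hc] at h ⊢
  have h3 : 2 * (2 + p) - 2 = 2 * p + 2 := by omega
  rw [h3, Nat.add_sub_cancel_left] at h
  nlinarith

/-- The independent set version of Brooks' theorem for maximum degree at least three. -/
theorem exists_indep_of_degree_le {q : ℕ} (hq : 3 ≤ q) (m : ℕ) :
    ∀ (H : SimpleGraph V) (S : Finset V), (∀ v ∈ S, (nbrIn H S v).card ≤ q) →
      (∀ C ⊆ S, C.card = q + 1 → ¬ H.IsClique C) → m * q + 1 ≤ S.card →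
      ∃ I ⊆ S, H.IsIndepSet I ∧ I.card = m + 1 := by
  classical
  induction m with
  | zero =>
    intro H S _ _ hS
    obtain ⟨v, hv⟩ := Finset.card_pos.1 (by omega : 0 < S.card)
    exact ⟨{v}, by simpa using hv, by simp [SimpleGraph.IsIndepSet], by simp⟩
  | succ m ih =>
    intro H S hdeg hcl hS
    by_cases hQ : ∃ Q ⊆ S, Q.card = q ∧ H.IsClique Q
    · obtain ⟨Q, hQS, hQc, hQ⟩ := hQ
      have hS' : m * q + 1 ≤ (S \ Q).card := by
        rw [Finset.card_sdiff_of_subset hQS, hQc]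
        have : (m + 1) * q = m * q + q := by ring
        omega
      have hmono : ∀ v, nbrIn H (S \ Q) v ⊆ nbrIn H S v := fun v y hy => by
        rw [mem_nbrIn] at hy ⊢
        exact ⟨(Finset.mem_sdiff.1 hy.1).1, hy.2⟩
      have hext : ∀ I ⊆ S \ Q, H.IsIndepSet I → I.card = m + 1 →
          (∃ x ∈ Q, ∀ y ∈ I, ¬ H.Adj x y) →
          ∃ I ⊆ S, H.IsIndepSet (I : Finset V) ∧ I.card = m + 1 + 1 := by
        rintro I hIS hI hIc ⟨x, hx, hxI⟩
        refine ⟨insert x I, Finset.insert_subset (hQS hx)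
          (hIS.trans Finset.sdiff_subset), ?_, ?_⟩
        · rw [Finset.coe_insert]
          exact Set.Pairwise.insert hI fun y hy _ =>
            ⟨hxI y hy, fun h => hxI y hy h.symm⟩
        · rw [Finset.card_insert_of_notMem fun h => (Finset.mem_sdiff.1 (hIS h)).2 hx, hIc]
      by_cases hout : ∃ x ∈ Q, ∀ y ∈ S \ Q, ¬ H.Adj x y
      · obtain ⟨x, hx, hxS⟩ := hout
        obtain ⟨I, hIS, hI, hIc⟩ := ih H (S \ Q)
          (fun v hv => (Finset.card_le_card (hmono v)).trans
            (hdeg v (Finset.sdiff_subset hv)))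
          (fun C hC => hcl C (hC.trans Finset.sdiff_subset)) hS'
        exact hext I hIS hI hIc ⟨x, hx, fun y hy => hxS y (hIS hy)⟩
      push Not at hout
      choose! f hfS hfa using hout
      have hfu : ∀ x ∈ Q, ∀ y ∈ S \ Q, H.Adj x y → y = f x := by
        intro x hx y hy hxy
        have h1 := Finset.mem_sdiff.1 (hfS x hx)
        have hnot : f x ∉ Q.erase x := fun h => h1.2 (Finset.mem_of_mem_erase h)
        have hn : nbrIn H S x = insert (f x) (Q.erase x) := by
          refine nbrIn_eq_of_card_le (hdeg x (hQS hx)) ?_ ?_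
          · refine Finset.insert_subset (mem_nbrIn.2 ⟨h1.1, hfa x hx⟩) fun z hz => ?_
            rw [Finset.mem_erase] at hz
            exact mem_nbrIn.2 ⟨hQS hz.2, hQ hx hz.2 hz.1.symm⟩
          · rw [Finset.card_insert_of_notMem hnot, Finset.card_erase_of_mem hx]
            omega
        rw [Finset.mem_sdiff] at hy
        have h2 : y ∈ nbrIn H S x := mem_nbrIn.2 ⟨hy.1, hxy⟩
        rw [hn, Finset.mem_insert] at h2
        exact h2.resolve_right fun h => hy.2 (Finset.mem_of_mem_erase h)
      obtain ⟨x, hx, y, hy, hxy, hgood⟩ :=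
        exists_good_pair hq hdeg hcl hQS hQc hQ f hfS hfa
      have hend : ∀ u ∈ Q, (nbrIn H (S \ Q) (f u)).card + 1 ≤ q := by
        intro u hu
        refine le_trans (Finset.card_lt_card ?_) (hdeg _ (Finset.mem_sdiff.1 (hfS u hu)).1)
        refine Finset.ssubset_iff_subset_ne.2 ⟨hmono _, fun h => ?_⟩
        have h1 : u ∈ nbrIn H S (f u) := mem_nbrIn.2 ⟨hQS hu, (hfa u hu).symm⟩
        rw [← h, mem_nbrIn, Finset.mem_sdiff] at h1
        exact h1.1.2 hu
      have hdeg' : ∀ v ∈ S \ Q,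
          (nbrIn (H ⊔ SimpleGraph.edge (f x) (f y)) (S \ Q) v).card ≤ q := by
        intro v hv
        by_cases hvx : v = f x
        · refine le_trans (Finset.card_le_card (t := insert (f y) (nbrIn H (S \ Q) (f x))) ?_)
            ((Finset.card_insert_le _ _).trans (hend x hx))
          intro z hz
          rw [mem_nbrIn, SimpleGraph.sup_adj, SimpleGraph.edge_adj] at hz
          rw [Finset.mem_insert, mem_nbrIn]
          grind
        by_cases hvy : v = f y
        · refine le_trans (Finset.card_le_card (t := insert (f x) (nbrIn H (S \ Q) (f y))) ?_)
            ((Finset.card_insert_le _ _).trans (hend y hy))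
          intro z hz
          rw [mem_nbrIn, SimpleGraph.sup_adj, SimpleGraph.edge_adj] at hz
          rw [Finset.mem_insert, mem_nbrIn]
          grind
        · refine le_trans (Finset.card_le_card fun z hz => ?_)
            (hdeg v (Finset.sdiff_subset hv))
          rw [mem_nbrIn, SimpleGraph.sup_adj, SimpleGraph.edge_adj] at hz
          rw [mem_nbrIn]
          exact ⟨(Finset.mem_sdiff.1 hz.1).1, by tauto⟩
      obtain ⟨I, hIS, hI, hIc⟩ := ih _ (S \ Q) hdeg' hgood hS'
      have hIH : H.IsIndepSet I := fun a ha b hb hab h =>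
        hI ha hb hab ((SimpleGraph.sup_adj ..).2 (Or.inl h))
      refine hext I hIS hIH hIc ?_
      by_cases hxI : f x ∈ I
      · refine ⟨y, hy, fun z hz h => ?_⟩
        obtain rfl := hfu y hy z (hIS hz) h
        refine hI hxI hz hxy ((SimpleGraph.sup_adj ..).2 (Or.inr ?_))
        exact (SimpleGraph.edge_adj ..).2 ⟨Or.inl ⟨rfl, rfl⟩, hxy⟩
      · exact ⟨x, hx, fun z hz h => hxI (hfu x hx z (hIS hz) h ▸ hz)⟩
    · push Not at hQ
      obtain ⟨I, hIS, hI, hSI⟩ := exists_indep_of_cliqueFree (by omega) hdeg hQ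
      have h1 : m + 1 < I.card := by
        by_contra hcon
        have := Nat.mul_le_mul_left q (not_lt.1 hcon)
        have : (m + 1) * q = q * (m + 1) := by ring
        omega
      obtain ⟨J, hJI, hJc⟩ := Finset.exists_subset_card_eq (Nat.succ_le_of_lt h1)
      exact ⟨J, hJI.trans hIS, hI.mono (Finset.coe_subset.2 hJI), hJc⟩

end IndependentSets

section RedCliques

variable {V : Type*} [Fintype V] [DecidableEq V] {R B : SimpleGraph V}

theorem card_le_nbrIn_add {D : ℕ}
    (hG : ∀ v, (nbrIn (R ⊔ B)ᶜ Finset.univ v).card + 1 ≤ D) (S : Finset V) (v : V) :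
    S.card ≤ (nbrIn R S v).card + (nbrIn B S v).card + D := by
  have hsub : S ⊆ nbrIn R S v ∪ nbrIn B S v ∪
      insert v (nbrIn (R ⊔ B)ᶜ Finset.univ v) := by
    intro x hx
    simp only [Finset.mem_union, Finset.mem_insert, mem_nbrIn, SimpleGraph.compl_adj,
      SimpleGraph.sup_adj, Finset.mem_univ, true_and, hx]
    have : x = v ↔ v = x := eq_comm
    tauto
  have h1 := Finset.card_le_card hsub
  have h2 := Finset.card_union_le (nbrIn R S v ∪ nbrIn B S v)
    (insert v (nbrIn (R ⊔ B)ᶜ Finset.univ v))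
  have h3 := Finset.card_union_le (nbrIn R S v) (nbrIn B S v)
  have h4 := Finset.card_insert_le v (nbrIn (R ⊔ B)ᶜ Finset.univ v)
  have h5 := hG v
  omega

theorem card_nbrIn_compl_le {D : ℕ}
    (hG : ∀ v, (nbrIn (R ⊔ B)ᶜ Finset.univ v).card + 1 ≤ D) (S : Finset V) (v : V) :
    (nbrIn Rᶜ S v).card + 1 ≤ (nbrIn B S v).card + D := by
  have hsub : nbrIn Rᶜ S v ⊆ nbrIn B S v ∪ nbrIn (R ⊔ B)ᶜ Finset.univ v := by
    intro x hx
    simp only [Finset.mem_union, mem_nbrIn, SimpleGraph.compl_adj,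
      SimpleGraph.sup_adj, Finset.mem_univ, true_and] at hx ⊢
    tauto
  have h1 := Finset.card_le_card hsub
  have h2 := Finset.card_union_le (nbrIn B S v) (nbrIn (R ⊔ B)ᶜ Finset.univ v)
  have h3 := hG v
  omega

theorem exists_red_clique {s k N D : ℕ} (hs : 2 ≤ s) (hk : 1 ≤ k) (hsk : s ≤ k + 2)
    (hN1 : s * k < N) (hN2 : N ≤ s * (k + 1)) (hD : D + N / (k + 1) ≤ N)
    (hRB : Disjoint R B) (hG : ∀ v, (nbrIn (R ⊔ B)ᶜ Finset.univ v).card + 1 ≤ D)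
    (hP : ∀ l, IsPathList B Finset.univ l → l.length ≠ s + 1) (m : ℕ) :
    ∀ S : Finset V, m * (N - 1) + 1 ≤ S.card →
      ∃ I ⊆ S, R.IsClique I ∧ I.card = m + 1 := by
  induction m with
  | zero =>
    intro S hS
    obtain ⟨v, hv⟩ := Finset.card_pos.1 (by omega : 0 < S.card)
    exact ⟨{v}, by simpa using hv, by simp, by simp⟩
  | succ m ih =>
    intro S hS
    have hm : (m + 1) * (N - 1) = m * (N - 1) + (N - 1) := by ring
    have hstep : ∀ v ∈ S, m * (N - 1) + 1 ≤ (nbrIn R S v).card →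
        ∃ I ⊆ S, R.IsClique (I : Finset V) ∧ I.card = m + 1 + 1 := by
      intro v hv h
      obtain ⟨I, hIS, hI, hIc⟩ := ih _ h
      have hIv := fun x (hx : x ∈ I) => mem_nbrIn.1 (hIS hx)
      refine ⟨insert v I, Finset.insert_subset hv fun x hx => (hIv x hx).1, ?_, ?_⟩
      · rw [Finset.coe_insert]
        exact hI.insert fun x hx _ => (hIv x hx).2
      · rw [Finset.card_insert_of_notMem fun h => (hIv v h).2.ne rfl, hIc]
    by_cases hlow : ∃ v ∈ S, (nbrIn B S v).card + D < N
    · obtain ⟨v, hv, hlow⟩ := hlow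
      have := card_le_nbrIn_add hG S v
      exact hstep v hv (by omega)
    push Not at hlow
    obtain ⟨v₀, hv₀⟩ : S.Nonempty := Finset.card_pos.1 (by omega)
    have hPS : ∀ l, IsPathList B S l → l.length ≠ s + 1 := fun l hl =>
      hP l ⟨hl.1, hl.2.1, fun x _ => Finset.mem_univ x⟩
    have hdiv1 : s - 1 ≤ N / (k + 1) := by
      rw [Nat.le_div_iff_mul_le (by omega)]
      obtain ⟨p, rfl⟩ := Nat.exists_eq_add_of_le hs
      have : 2 + p - 1 = p + 1 := by omega
      rw [this]
      nlinarith
    have hdiv2 : N / (k + 1) < s := by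
      by_contra hcon
      obtain ⟨l, hl, hlen, -⟩ := exists_pathList (G := B) (c := s)
        (fun v hv => by have := hlow v hv; omega) hv₀
      exact hPS l hl hlen
    have hdiv3 : N < s * (k + 1) := (Nat.div_lt_iff_lt_mul (by omega)).1 hdiv2
    have hT := fun v (hv : v ∈ S) => exists_component hs
      (fun v hv => by have := hlow v hv; omega) hPS hv
    have hBdeg : ∀ v ∈ S, (nbrIn B S v).card = s - 1 := by
      intro v hv
      obtain ⟨T, -, hvT, hTc, hTn⟩ := hT v hv
      rw [hTn v hvT, Finset.card_erase_of_mem hvT, hTc]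
    have hHdeg : ∀ v ∈ S, (nbrIn Rᶜ S v).card ≤ N - 1 := by
      intro v hv
      have h1 := hBdeg v hv
      have h2 := card_nbrIn_compl_le hG S v
      omega
    have hN3 : 3 ≤ N := by nlinarith
    by_cases hN4 : 3 ≤ N - 1
    · obtain ⟨I, hIS, hI, hIc⟩ := exists_indep_of_degree_le hN4 (m + 1) Rᶜ S hHdeg
        (fun C hCS hCc hC => by
          have hdvd : s ∣ C.card := by
            refine dvd_card_of_closed hT hCS fun v hv x hx => ?_
            rw [mem_nbrIn] at hx
            have hn : nbrIn Rᶜ S v = C.erase v := by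
              refine nbrIn_eq_of_card_le (hHdeg v (hCS hv)) (fun y hy => ?_)
                (by rw [Finset.card_erase_of_mem hv]; omega)
              rw [Finset.mem_erase] at hy
              exact mem_nbrIn.2 ⟨hCS hy.2, hC hv hy.2 hy.1.symm⟩
            have h1 : x ∈ nbrIn Rᶜ S v := by
              refine mem_nbrIn.2 ⟨hx.1, (SimpleGraph.compl_adj ..).2 ⟨hx.2.ne, fun h => ?_⟩⟩
              exact SimpleGraph.disjoint_left.1 hRB v x h hx.2
            rw [hn] at h1
            exact Finset.mem_of_mem_erase h1
          obtain ⟨c, hc⟩ := hdvd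
          have hNc : N = s * c := by omega
          rw [hNc] at hN1 hdiv3
          have h1 := Nat.lt_of_mul_lt_mul_left hN1
          have h2 := Nat.lt_of_mul_lt_mul_left hdiv3
          omega) hS
      refine ⟨I, hIS, fun x hx y hy hxy => ?_, hIc⟩
      by_contra h
      exact hI hx hy hxy ((SimpleGraph.compl_adj ..).2 ⟨hxy, h⟩)
    · obtain rfl : N = 3 := by omega
      obtain rfl : s = 2 := by
        by_contra h
        have : 3 ≤ s := by omega
        nlinarith
      have heven := dvd_card_of_closed hT subset_rfl
        fun v _ x hx => (mem_nbrIn.1 hx).1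
      have h1 := hBdeg v₀ hv₀
      have h2 := card_le_nbrIn_add hG S v₀
      exact hstep v₀ hv₀ (by omega)

end RedCliques

theorem stmt_18 {V : Type*} [Fintype V] [DecidableEq V]
    (r t k n : ℕ) (hr : 2 ≤ r) (ht : 3 ≤ t) (hk : 1 ≤ k) (hkt : t - 3 ≤ k)
    (hn1 : (r - 1) * (t - 1) * k < n) (hn2 : n ≤ (r - 1) * (t - 1) * (k + 1))
    (G : SimpleGraph V) [DecidableRel G.Adj] (hcard : Fintype.card V = n)
    (hdeg : (G.minDegree : ℤ) ≥ (n : ℤ) - ⌈((k : ℚ) / (k + 1)) * ⌈(n : ℚ) / (r - 1)⌉⌉)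
    (R B : SimpleGraph V) (hunion : R ⊔ B = G) (hdisj : R ⊓ B = ⊥) :
    (∃ s : Finset V, R.IsNClique r s) ∨
    (∃ (u v : V) (p : B.Walk u v), p.IsPath ∧ p.length + 1 = t) := by
  by_contra! hcon
  obtain ⟨m, rfl⟩ : ∃ m, r = m + 1 := ⟨r - 1, by omega⟩
  obtain ⟨s, rfl⟩ : ∃ s, t = s + 1 := ⟨t - 1, by omega⟩
  simp only [Nat.add_sub_cancel] at hn1 hn2
  have hm : 0 < m := by omega
  have hmQ : (0 : ℚ) < m := by exact_mod_cast hm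
  have hr1 : ((m + 1 : ℕ) : ℚ) - 1 = m := by push_cast; ring
  rw [hr1] at hdeg
  obtain ⟨N, hN⟩ : ∃ N : ℕ, ⌈(n : ℚ) / m⌉ = N :=
    Int.eq_ofNat_of_zero_le (Int.ceil_nonneg (by positivity))
  rw [hN] at hdeg
  have hNle : n ≤ m * N := by
    have h := Int.le_ceil ((n : ℚ) / m)
    rw [hN, div_le_iff₀ hmQ] at h
    have h' : (n : ℚ) ≤ (m * N : ℕ) := by push_cast at h ⊢; linarith
    exact_mod_cast h'
  have hNlt : m * N < n + m := by
    have h := Int.ceil_lt_add_one ((n : ℚ) / m)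
    rw [hN, div_add_one hmQ.ne', lt_div_iff₀ hmQ] at h
    have h' : ((m * N : ℕ) : ℚ) < (n + m : ℕ) := by push_cast at h ⊢; linarith
    exact_mod_cast h'
  have hN1 : s * k < N := by
    refine Nat.lt_of_mul_lt_mul_left (a := m) ?_
    rw [← mul_assoc]
    omega
  have hN2 : N ≤ s * (k + 1) := by
    refine Nat.lt_succ_iff.1 (Nat.lt_of_mul_lt_mul_left (a := m) ?_)
    rw [Nat.mul_succ, ← mul_assoc]
    omega
  have hk0 : (0 : ℚ) < (k : ℚ) + 1 := by positivity
  obtain ⟨D, hDeq⟩ : ∃ D : ℕ, ⌈((k : ℚ) / (k + 1)) * ((N : ℤ) : ℚ)⌉ = D :=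
    Int.eq_ofNat_of_zero_le (Int.ceil_nonneg (by positivity))
  rw [hDeq] at hdeg
  have hD : D + N / (k + 1) ≤ N := by
    have h1 : ⌈((k : ℚ) / (k + 1)) * ((N : ℤ) : ℚ)⌉ ≤ (N : ℤ) - ((N / (k + 1) : ℕ) : ℤ) := by
      rw [Int.ceil_le]
      have h2 : ((N / (k + 1) : ℕ) : ℚ) ≤ (N : ℚ) / ((k + 1 : ℕ) : ℚ) := Nat.cast_div_le
      have h3 : (k : ℚ) / (k + 1) * N = N - (N : ℚ) / ((k + 1 : ℕ) : ℚ) := by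
        push_cast
        field_simp
        ring
      rw [Int.cast_sub, Int.cast_natCast, Int.cast_natCast, h3]
      linarith
    rw [hDeq] at h1
    omega
  have hG : ∀ v, (nbrIn (R ⊔ B)ᶜ Finset.univ v).card + 1 ≤ D := by
    intro v
    have h1 : nbrIn (R ⊔ B)ᶜ Finset.univ v = Gᶜ.neighborFinset v := by
      ext x
      simp [mem_nbrIn, hunion]
    have h2 := G.minDegree_le_degree v
    have h3 := G.degree_lt_card_verts v
    have h4 := G.degree_compl v
    rw [h1, SimpleGraph.card_neighborFinset_eq_degree]
    omega
  obtain ⟨I, -, hI, hIc⟩ := exists_red_clique (by omega) hk (by omega) hN1 hN2 hD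
    (disjoint_iff.2 hdisj) hG (fun l hl hlen => by
      obtain ⟨u, v, p, hp, hpl⟩ := hl.exists_walk (by rintro rfl; simp at hlen)
      exact hcon.2 u v p hp (hpl.trans hlen)) m Finset.univ (by
        rw [Finset.card_univ, hcard, Nat.mul_sub_one]
        omega)
  exact hcon.1 I ⟨hI, hIc⟩
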